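/- arXiv:2307.15103 — 3 statements merged into one kernel-verified Lean document; each statement's English description precedes it below -/
import Mathlib

section
/- Suppose α(t) ≠ 0 for all t ∈ I and there exists a solution ρ ∈ C¹(I, ℂ) of the Riccati equation (R). Then for any t₀ ∈ I and x₀, x₀' ∈ ℂⁿ, the solution x of (E) with x(t₀) = x₀ and x'(t₀) = x₀' is given for all t ∈ I by x(t) = [ x₀ + ∫_{t₀}^{t} ( x₀' − ρ(t₀)x₀ + ∫_{t₀}^{s} (e^{∫_{t₀}^{μ} (ρ(ν) + β(ν)/α(ν)) dν} / α(μ)) f(μ) dμ ) e^{−∫_{t₀}^{s} (2ρ(μ) + β(μ)/α(μ)) dμ} ds ] e^{∫_{t₀}^{t} ρ(s) ds}. -/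
open MeasureTheory Set

open intervalIntegral in
/-- Variation of constants for the first-order linear equation `y' + p y = g`. -/
theorem eq_exp_smul_add_integral_of_hasDerivAt {E : Type*} [NormedAddCommGroup E]
    [NormedSpace ℂ E] [CompleteSpace E] {a b : ℝ} {p : ℝ → ℂ} {g y : ℝ → E}
    (hp : ContinuousOn p (uIcc a b)) (hg : ContinuousOn g (uIcc a b))
    (hy : ContinuousOn y (uIcc a b))
    (hy' : ∀ s ∈ Ioo (min a b) (max a b), HasDerivAt y (g s - p s • y s) s) :
    y b = Complex.exp (-∫ s in a..b, p s) •
      (y a + ∫ s in a..b, Complex.exp (∫ u in a..s, p u) • g s) := by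
  have hsub : Ioo (min a b) (max a b) ⊆ uIcc a b := Ioo_subset_Icc_self
  have hPc : ContinuousOn (fun s => Complex.exp (∫ u in a..s, p u)) (uIcc a b) :=
    (continuousOn_primitive_interval (hp.integrableOn_uIcc)).cexp
  have hP' : ∀ s ∈ Ioo (min a b) (max a b),
      HasDerivAt (fun s => ∫ u in a..s, p u) (p s) s := fun s hs =>
    integral_hasDerivAt_right
      ((hp.mono (uIcc_subset_uIcc_left (hsub hs))).intervalIntegrable)
      ((hp.mono hsub).stronglyMeasurableAtFilter isOpen_Ioo s hs)
      ((hp.mono hsub).continuousAt (isOpen_Ioo.mem_nhds hs))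
  have key := integral_eq_sub_of_hasDeriv_right (hPc.smul hy)
    (f' := fun s => Complex.exp (∫ u in a..s, p u) • g s)
    (fun s hs => by
      have h := (hP' s hs).cexp.smul (hy' s hs)
      convert h.hasDerivWithinAt using 1
      module)
    (hPc.smul hg).intervalIntegrable
  rw [key]
  simp [smul_smul, ← Complex.exp_add]

/-- Representation of the solution of
`α(t) x'' + β(t) x' + γ(t) x = f(t)` with initial conditions `x(t₀) = x₀`,
`x'(t₀) = x₀'`, given a C¹ solution `ρ` of the Riccati equation
`α(t)(ρ' + ρ²) + β(t)ρ + γ(t) = 0` on the interval `I`. -/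
theorem solution_representation (n : ℕ) (I : Set ℝ) (hI : I.OrdConnected)
    (α β γ : ℝ → ℂ) (f : ℝ → EuclideanSpace ℂ (Fin n))
    (hα : ContinuousOn α I) (hβ : ContinuousOn β I) (hγ : ContinuousOn γ I)
    (hf : ContinuousOn f I) (hα0 : ∀ t ∈ I, α t ≠ 0)
    (ρ ρ' : ℝ → ℂ) (hρc : ContinuousOn ρ' I)
    (hρd : ∀ t ∈ I, HasDerivWithinAt ρ (ρ' t) I t)
    (hRic : ∀ t ∈ I, α t * (ρ' t + ρ t ^ 2) + β t * ρ t + γ t = 0)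
    (t₀ : ℝ) (ht₀ : t₀ ∈ I) (x₀ x₀' : EuclideanSpace ℂ (Fin n))
    (x xd xdd : ℝ → EuclideanSpace ℂ (Fin n))
    (hxd : ∀ t ∈ I, HasDerivWithinAt x (xd t) I t)
    (hxdd : ∀ t ∈ I, HasDerivWithinAt xd (xdd t) I t)
    (hxddc : ContinuousOn xdd I)
    (heq : ∀ t ∈ I, α t • xdd t + β t • xd t + γ t • x t = f t)
    (hic : x t₀ = x₀) (hic' : xd t₀ = x₀') :
    ∀ t ∈ I, x t =
      Complex.exp (∫ s in t₀..t, ρ s) •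
        (x₀ + ∫ s in t₀..t,
          Complex.exp (-∫ μ in t₀..s, (2 * ρ μ + β μ / α μ)) •
            (x₀' - ρ t₀ • x₀ +
              ∫ μ in t₀..s,
                (Complex.exp (∫ ν in t₀..μ, (ρ ν + β ν / α ν)) / α μ) • f μ)) := by
  have hsub : ∀ t ∈ I, uIcc t₀ t ⊆ I := fun t ht => hI.uIcc_subset ht₀ ht
  have hnhds : ∀ t ∈ I, ∀ s ∈ Ioo (min t₀ t) (max t₀ t), s ∈ I ∧ I ∈ nhds s := fun t ht s hs =>
    ⟨hsub t ht (Ioo_subset_Icc_self hs),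
      Filter.mem_of_superset (isOpen_Ioo.mem_nhds hs) (Ioo_subset_Icc_self.trans (hsub t ht))⟩
  have hρ : ContinuousOn ρ I := fun t ht => (hρd t ht).continuousWithinAt
  have hx : ContinuousOn x I := fun t ht => (hxd t ht).continuousWithinAt
  have hx' : ContinuousOn xd I := fun t ht => (hxdd t ht).continuousWithinAt
  have hv : ContinuousOn (fun s => xd s - ρ s • x s) I := hx'.sub (hρ.smul hx)
  have hq : ContinuousOn (fun s => ρ s + β s / α s) I := hρ.add (hβ.div hα hα0)
  have hv_eq : ∀ t ∈ I, xd t - ρ t • x t =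
      Complex.exp (-∫ μ in t₀..t, (ρ μ + β μ / α μ)) • (x₀' - ρ t₀ • x₀ +
        ∫ μ in t₀..t, (Complex.exp (∫ ν in t₀..μ, (ρ ν + β ν / α ν)) / α μ) • f μ) := by
    intro t ht
    have h := eq_exp_smul_add_integral_of_hasDerivAt (a := t₀) (b := t)
      (g := fun s => (α s)⁻¹ • f s) (hq.mono (hsub t ht))
      (((hα.inv₀ hα0).smul hf).mono (hsub t ht)) (hv.mono (hsub t ht)) (by
        intro s hs
        obtain ⟨hsI, hsn⟩ := hnhds t ht s hs
        have h := ((hxdd s hsI).sub ((hρd s hsI).smul (hxd s hsI))).hasDerivAt hsn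
        refine h.congr_deriv ?_
        have hα' := hα0 s hsI
        have hγ' : γ s = -(α s * (ρ' s + ρ s ^ 2) + β s * ρ s) := by
          linear_combination hRic s hsI
        rw [← heq s hsI, hγ']
        ext i
        simp only [PiLp.add_apply, PiLp.sub_apply, PiLp.smul_apply, smul_eq_mul]
        field_simp
        ring)
    simpa only [hic, hic', smul_smul, div_eq_mul_inv] using h
  intro t ht
  have h := eq_exp_smul_add_integral_of_hasDerivAt (a := t₀) (b := t) (p := fun s => -ρ s)
    (hρ.neg.mono (hsub t ht)) (hv.mono (hsub t ht)) (hx.mono (hsub t ht)) (by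
      intro s hs
      obtain ⟨hsI, hsn⟩ := hnhds t ht s hs
      convert (hxd s hsI).hasDerivAt hsn using 1
      module)
  simp only [intervalIntegral.integral_neg, neg_neg, hic] at h
  rw [h]
  congr 2
  refine intervalIntegral.integral_congr fun s hs => ?_
  have hsI := hsub t ht hs
  have hadd : ∫ μ in t₀..s, (2 * ρ μ + β μ / α μ) =
      (∫ μ in t₀..s, ρ μ) + ∫ μ in t₀..s, (ρ μ + β μ / α μ) := by
    rw [← intervalIntegral.integral_add (hρ.mono (hsub s hsI)).intervalIntegrable
      (hq.mono (hsub s hsI)).intervalIntegrable]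
    congr 1
    ext μ
    ring
  simp only [hv_eq s hsI, smul_smul, ← Complex.exp_add, hadd, neg_add]
end

section
/- Let I be one of the intervals (τ,σ), (τ,σ], [τ,σ), [τ,σ] with −∞ ≤ τ < σ ≤ ∞. Suppose α(t) ≠ 0 for all t ∈ I and there exists a C¹ solution ρ : I → ℂ of the Riccati equation (R). Suppose the integrals f₁(t) = ∫_t^σ ( e^{∫_t^s Re(ρ(μ) + β(μ)/α(μ)) dμ} / |α(s)| ) ds and f₂(t) = ∫_t^σ e^{−∫_t^s Re(ρ(μ)) dμ} ds converge for all t ∈ I, and that sup_{t∈I} f₁(t) < ∞ and sup_{t∈I} f₂(t) < ∞. Then (E) is Ulam stable on I, and L₁ = sup_{t∈I} ∫_t^σ ( ∫_s^σ ( e^{∫_s^μ Re(ρ(ν) + β(ν)/α(ν)) dν} / |α(μ)| ) dμ ) e^{−∫_t^s Re(ρ(μ)) dμ} ds is an Ulam constant for (E) on I. -/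
open MeasureTheory Set

/-- The set of real numbers strictly between `t` and the extended real `σ`. -/
def IooE (t : ℝ) (σ : EReal) : Set ℝ := {s : ℝ | t < s ∧ (s : EReal) < σ}

/-- The function `f₁(t) = ∫_t^σ e^{∫_t^s Re(ρ + β/α) dμ} / |α(s)| ds`. -/
noncomputable def f₁ (σ : EReal) (α β ρ : ℝ → ℂ) (t : ℝ) : ℝ :=
  ∫ s in IooE t σ, Real.exp (∫ μ in t..s, (ρ μ + β μ / α μ).re) / ‖α s‖

/-- The function `f₂(t) = ∫_t^σ e^{-∫_t^s Re(ρ) dμ} ds`. -/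
noncomputable def f₂ (σ : EReal) (ρ : ℝ → ℂ) (t : ℝ) : ℝ :=
  ∫ s in IooE t σ, Real.exp (-∫ μ in t..s, (ρ μ).re)

/-- `L` is an Ulam constant for `α(t)x'' + β(t)x' + γ(t)x = f(t)` on `I`:
`L > 0` and for every `ε > 0` and every C² function `ξ` with
`sup_{t∈I} ‖α ξ'' + β ξ' + γ ξ - f‖ ≤ ε` there is a solution `x` of the equation on `I`
with `sup_{t∈I} ‖ξ - x‖ ≤ L ε`. -/
def IsUlamConstant (n : ℕ) (I : Set ℝ) (α β γ : ℝ → ℂ)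
    (f : ℝ → EuclideanSpace ℂ (Fin n)) (L : ℝ) : Prop :=
  0 < L ∧ ∀ ε > 0, ∀ ξ ξd ξdd : ℝ → EuclideanSpace ℂ (Fin n),
    (∀ t ∈ I, HasDerivWithinAt ξ (ξd t) I t) →
    (∀ t ∈ I, HasDerivWithinAt ξd (ξdd t) I t) →
    ContinuousOn ξdd I →
    (∀ t ∈ I, ‖α t • ξdd t + β t • ξd t + γ t • ξ t - f t‖ ≤ ε) →
    ∃ x xd xdd : ℝ → EuclideanSpace ℂ (Fin n),
      (∀ t ∈ I, HasDerivWithinAt x (xd t) I t) ∧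
      (∀ t ∈ I, HasDerivWithinAt xd (xdd t) I t) ∧
      ContinuousOn xdd I ∧
      (∀ t ∈ I, α t • xdd t + β t • xd t + γ t • x t = f t) ∧
      ∀ t ∈ I, ‖ξ t - x t‖ ≤ L * ε

theorem measurableSet_IooE (t : ℝ) (σ : EReal) : MeasurableSet (IooE t σ) :=
  (measurableSet_lt measurable_const measurable_id).inter
    (measurableSet_lt measurable_coe_real_ereal measurable_const)

theorem ContinuousOn.intervalIntegrable_of_ordConnected {I : Set ℝ} (hI : I.OrdConnected)
    {E : Type*} [NormedAddCommGroup E] {h : ℝ → E} (hh : ContinuousOn h I) {a b : ℝ} (ha : a ∈ I)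
    (hb : b ∈ I) :
    IntervalIntegrable h volume a b :=
  (hh.mono (hI.uIcc_subset ha hb)).intervalIntegrable

section TailIntegral

variable {E : Type*} [NormedAddCommGroup E] [NormedSpace ℝ E]

theorem hasDerivWithinAt_integral_of_ordConnected [CompleteSpace E] {I : Set ℝ}
    (hI : I.OrdConnected) {h : ℝ → E} (hh : ContinuousOn h I) {a t : ℝ} (ha : a ∈ I)
    (ht : t ∈ I) : HasDerivWithinAt (fun u => ∫ s in a..u, h s) (h t) I t := by
  rw [hasDerivWithinAt_iff_isLittleO, Asymptotics.isLittleO_iff]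
  intro c hc
  obtain ⟨δ, hδ, hball⟩ := Metric.continuousOn_iff.1 hh t ht c hc
  filter_upwards [self_mem_nhdsWithin, mem_nhdsWithin_of_mem_nhds (Metric.ball_mem_nhds t hδ)]
    with u hu hud
  have hint {x y : ℝ} (hx : x ∈ I) (hy : y ∈ I) :=
    hh.intervalIntegrable_of_ordConnected hI hx hy
  rw [intervalIntegral.integral_interval_sub_left (hint ha hu) (hint ha ht),
    ← intervalIntegral.integral_const, ← intervalIntegral.integral_sub (hint ht hu)
      intervalIntegrable_const, Real.norm_eq_abs]
  refine intervalIntegral.norm_integral_le_of_norm_le_const fun s hs => ?_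
  have hs' := uIoc_subset_uIcc hs
  rw [← dist_eq_norm]
  refine (hball s (hI.uIcc_subset ht hu hs') ?_).le
  have := abs_sub_left_of_mem_uIcc hs'
  rw [Metric.mem_ball, Real.dist_eq] at hud
  rw [Real.dist_eq]
  exact this.trans_lt hud

theorem integral_IooE_eq_add {I : Set ℝ} (hI : I.OrdConnected) {σ : EReal}
    (hσ : ∀ t ∈ I, (t : EReal) ≤ σ) {h : ℝ → E} (hh : ContinuousOn h I)
    (hint : ∀ t ∈ I, IntegrableOn h (IooE t σ)) {t u : ℝ} (ht : t ∈ I) (hu : u ∈ I)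
    (htu : t ≤ u) :
    ∫ s in IooE t σ, h s = (∫ s in t..u, h s) + ∫ s in IooE u σ, h s := by
  rcases htu.eq_or_lt with rfl | htu
  · simp
  have hset : insert u (IooE t σ) = Ioc t u ∪ IooE u σ := by
    ext s
    simp only [IooE, mem_insert_iff, mem_ofPred_eq, mem_union, mem_Ioc]
    constructor
    · rintro (rfl | ⟨h1, h2⟩)
      · exact Or.inl ⟨htu, le_rfl⟩
      · rcases le_or_gt s u with h3 | h3
        · exact Or.inl ⟨h1, h3⟩
        · exact Or.inr ⟨h3, h2⟩
    · rintro (⟨h1, h2⟩ | ⟨h1, h2⟩)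
      · rcases h2.eq_or_lt with h3 | h3
        · exact Or.inl h3
        · exact Or.inr ⟨h1, (EReal.coe_lt_coe_iff.2 h3).trans_le (hσ u hu)⟩
      · exact Or.inr ⟨htu.trans h1, h2⟩
  have hdisj : Disjoint (Ioc t u) (IooE u σ) :=
    Set.disjoint_left.2 fun s hs hs' => hs.2.not_gt hs'.1
  rw [← setIntegral_congr_set (insert_ae_eq_self u (IooE t σ)), hset,
    setIntegral_union hdisj (measurableSet_IooE u σ)
      ((intervalIntegrable_iff_integrableOn_Ioc_of_le htu.le).1
        (hh.intervalIntegrable_of_ordConnected hI ht hu)) (hint u hu),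
    intervalIntegral.integral_of_le htu.le]

theorem hasDerivWithinAt_integral_IooE [CompleteSpace E] {I : Set ℝ} (hI : I.OrdConnected)
    {σ : EReal} (hσ : ∀ t ∈ I, (t : EReal) ≤ σ) {h : ℝ → E} (hh : ContinuousOn h I)
    (hint : ∀ t ∈ I, IntegrableOn h (IooE t σ)) {t : ℝ} (ht : t ∈ I) :
    HasDerivWithinAt (fun u => ∫ s in IooE u σ, h s) (-h t) I t := by
  have key (u : ℝ) (hu : u ∈ I) :
      ∫ s in IooE u σ, h s = (∫ s in IooE t σ, h s) - ∫ s in t..u, h s := by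
    rcases le_total t u with htu | htu
    · rw [integral_IooE_eq_add hI hσ hh hint ht hu htu]; abel
    · rw [integral_IooE_eq_add hI hσ hh hint hu ht htu, intervalIntegral.integral_symm t u]
      abel
  exact ((hasDerivWithinAt_integral_of_ordConnected hI hh ht ht).const_sub _).congr key
    (key t ht)

end TailIntegral

theorem norm_exp_intervalIntegral {I : Set ℝ} (hI : I.OrdConnected) {q : ℝ → ℂ}
    (hq : ContinuousOn q I) {t s : ℝ} (ht : t ∈ I) (hs : s ∈ I) :
    ‖Complex.exp (∫ μ in t..s, q μ)‖ = Real.exp (∫ μ in t..s, (q μ).re) := by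
  rw [Complex.norm_exp]
  congr 1
  exact (Complex.reCLM.intervalIntegral_comp_comm
    (hq.intervalIntegrable_of_ordConnected hI ht hs)).symm

/-- The primitive from `t` differs by a constant from the primitive from `a`. -/
theorem exp_intervalIntegral_eq {I : Set ℝ} (hI : I.OrdConnected) {q : ℝ → ℂ}
    (hq : ContinuousOn q I) {a t s : ℝ} (ha : a ∈ I) (ht : t ∈ I) (hs : s ∈ I) :
    Complex.exp (∫ μ in t..s, q μ) =
      Complex.exp (-∫ μ in a..t, q μ) * Complex.exp (∫ μ in a..s, q μ) := by
  rw [← Complex.exp_add, ← intervalIntegral.integral_interval_sub_left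
    (hq.intervalIntegrable_of_ordConnected hI ha hs)
    (hq.intervalIntegrable_of_ordConnected hI ha ht)]
  ring_nf

theorem continuousOn_exp_intervalIntegral {I : Set ℝ} (hI : I.OrdConnected) {q : ℝ → ℂ}
    (hq : ContinuousOn q I) {a : ℝ} (ha : a ∈ I) :
    ContinuousOn (fun s => Complex.exp (∫ μ in a..s, q μ)) I := fun _ ht =>
  (hasDerivWithinAt_integral_of_ordConnected hI hq ha ht).continuousWithinAt.cexp

/-- Variation of constants from the right end point: the function
`t ↦ -∫_t^σ e^{∫_t^s q} g(s) ds` solves `w' = g - q w`. -/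
theorem hasDerivWithinAt_variation_of_constants {E : Type*} [NormedAddCommGroup E]
    [NormedSpace ℂ E] [CompleteSpace E] {I : Set ℝ} (hI : I.OrdConnected) {σ : EReal}
    (hσ : ∀ t ∈ I, (t : EReal) ≤ σ) (hsub : ∀ t ∈ I, IooE t σ ⊆ I)
    {q : ℝ → ℂ} (hq : ContinuousOn q I) {g : ℝ → E} (hg : ContinuousOn g I)
    (hint : ∀ t ∈ I, IntegrableOn (fun s => Complex.exp (∫ μ in t..s, q μ) • g s) (IooE t σ))
    {t : ℝ} (ht : t ∈ I) :
    HasDerivWithinAt (fun u => -∫ s in IooE u σ, Complex.exp (∫ μ in u..s, q μ) • g s)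
      (g t - q t • (-∫ s in IooE t σ, Complex.exp (∫ μ in t..s, q μ) • g s)) I t := by
  have hexp := continuousOn_exp_intervalIntegral hI hq ht
  set h : ℝ → E := fun s => Complex.exp (∫ μ in t..s, q μ) • g s with hh_def
  have hh : ContinuousOn h I := hexp.smul hg
  have heq (u : ℝ) (hu : u ∈ I) (s : ℝ) (hs : s ∈ I) :
      Complex.exp (∫ μ in u..s, q μ) • g s = Complex.exp (-∫ μ in t..u, q μ) • h s := by
    rw [hh_def, exp_intervalIntegral_eq hI hq ht hu hs, mul_smul]
  have hhint (u : ℝ) (hu : u ∈ I) : IntegrableOn h (IooE u σ) := by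
    have h2 := (hint u hu).smul (Complex.exp (∫ μ in t..u, q μ))
    refine IntegrableOn.congr_fun h2 (fun s hs => ?_) (measurableSet_IooE u σ)
    simp only [Pi.smul_apply]
    rw [heq u hu s (hsub u hu hs), smul_smul, ← Complex.exp_add]
    simp
  have hval (u : ℝ) (hu : u ∈ I) :
      -∫ s in IooE u σ, Complex.exp (∫ μ in u..s, q μ) • g s =
        -(Complex.exp (-∫ μ in t..u, q μ) • ∫ s in IooE u σ, h s) := by
    rw [setIntegral_congr_fun (measurableSet_IooE u σ)
      fun s hs => heq u hu s (hsub u hu hs), integral_smul]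
  have hd := ((hasDerivWithinAt_integral_of_ordConnected hI hq ht ht).neg.cexp.smul
    (hasDerivWithinAt_integral_IooE hI hσ hh hhint ht)).neg
  refine (hd.congr hval (hval t ht)).congr_deriv ?_
  simp [hh_def, add_comm]

theorem continuousOn_f₁ {I : Set ℝ} (hI : I.OrdConnected) {σ : EReal}
    (hσ : ∀ t ∈ I, (t : EReal) ≤ σ) (hsub : ∀ t ∈ I, IooE t σ ⊆ I) {α β ρ : ℝ → ℂ}
    (hα : ContinuousOn α I) (hp : ContinuousOn (fun t => ρ t + β t / α t) I)
    (hα0 : ∀ t ∈ I, α t ≠ 0)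
    (hint : ∀ t ∈ I, IntegrableOn
      (fun s => Real.exp (∫ μ in t..s, (ρ μ + β μ / α μ).re) / ‖α s‖) (IooE t σ)) :
    ContinuousOn (f₁ σ α β ρ) I := by
  have hq : ContinuousOn (fun t => (((ρ t + β t / α t).re : ℝ) : ℂ)) I :=
    Complex.continuous_ofReal.comp_continuousOn (Complex.continuous_re.comp_continuousOn hp)
  have hg : ContinuousOn (fun t => ((‖α t‖⁻¹ : ℝ) : ℂ)) I :=
    Complex.continuous_ofReal.comp_continuousOn
      (hα.norm.inv₀ fun t ht => norm_ne_zero_iff.2 (hα0 t ht))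
  have heq (t s : ℝ) : Complex.exp (∫ μ in t..s, (((ρ μ + β μ / α μ).re : ℝ) : ℂ)) •
      ((‖α s‖⁻¹ : ℝ) : ℂ) =
      ((Real.exp (∫ μ in t..s, (ρ μ + β μ / α μ).re) / ‖α s‖ : ℝ) : ℂ) := by
    rw [intervalIntegral.integral_ofReal, smul_eq_mul, ← Complex.ofReal_exp,
      ← Complex.ofReal_mul, div_eq_mul_inv]
  have hcont : ContinuousOn (fun u => -∫ s in IooE u σ,
      Complex.exp (∫ μ in u..s, (((ρ μ + β μ / α μ).re : ℝ) : ℂ)) •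
        ((‖α s‖⁻¹ : ℝ) : ℂ)) I := fun t ht =>
    (hasDerivWithinAt_variation_of_constants hI hσ hsub hq hg (fun t ht => by
      simp only [heq]
      exact (hint t ht).ofReal) ht).continuousWithinAt
  refine (Complex.continuous_re.comp_continuousOn hcont.neg).congr fun t _ => ?_
  simp only [heq, Function.comp_apply, Pi.neg_apply, neg_neg, f₁]
  rw [integral_complex_ofReal, Complex.ofReal_re]

/-- Theorem 3.1 (i). -/
theorem ulam_stability_case_i (n : ℕ) (τ σ : EReal) (hτσ : τ < σ) (I : Set ℝ)
    (hI : I = {t : ℝ | τ < (t : EReal) ∧ (t : EReal) < σ} ∨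
          I = {t : ℝ | τ < (t : EReal) ∧ (t : EReal) ≤ σ} ∨
          I = {t : ℝ | τ ≤ (t : EReal) ∧ (t : EReal) < σ} ∨
          I = {t : ℝ | τ ≤ (t : EReal) ∧ (t : EReal) ≤ σ})
    (α β γ : ℝ → ℂ) (f : ℝ → EuclideanSpace ℂ (Fin n))
    (hα : ContinuousOn α I) (hβ : ContinuousOn β I) (hγ : ContinuousOn γ I)
    (hf : ContinuousOn f I) (hα0 : ∀ t ∈ I, α t ≠ 0)
    (ρ ρ' : ℝ → ℂ) (hρc : ContinuousOn ρ' I)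
    (hρd : ∀ t ∈ I, HasDerivWithinAt ρ (ρ' t) I t)
    (hRic : ∀ t ∈ I, α t * (ρ' t + ρ t ^ 2) + β t * ρ t + γ t = 0)
    (hf₁int : ∀ t ∈ I, IntegrableOn
      (fun s => Real.exp (∫ μ in t..s, (ρ μ + β μ / α μ).re) / ‖α s‖) (IooE t σ))
    (hf₂int : ∀ t ∈ I, IntegrableOn
      (fun s => Real.exp (-∫ μ in t..s, (ρ μ).re)) (IooE t σ))
    (hf₁bdd : BddAbove (f₁ σ α β ρ '' I))
    (hf₂bdd : BddAbove (f₂ σ ρ '' I)) :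
    (∃ L, IsUlamConstant n I α β γ f L) ∧
      IsUlamConstant n I α β γ f
        (sSup ((fun t => ∫ s in IooE t σ,
          (∫ μ in IooE s σ, Real.exp (∫ ν in s..μ, (ρ ν + β ν / α ν).re) / ‖α μ‖) *
            Real.exp (-∫ μ in t..s, (ρ μ).re)) '' I)) := by
  have hI' : I.OrdConnected := by
    refine ⟨fun a ha b hb c hc => ?_⟩
    have h1 := EReal.coe_le_coe_iff.2 hc.1
    have h2 := EReal.coe_le_coe_iff.2 hc.2
    rcases hI with rfl | rfl | rfl | rfl
    · exact ⟨ha.1.trans_le h1, h2.trans_lt hb.2⟩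
    · exact ⟨ha.1.trans_le h1, h2.trans hb.2⟩
    · exact ⟨ha.1.trans h1, h2.trans_lt hb.2⟩
    · exact ⟨ha.1.trans h1, h2.trans hb.2⟩
  have hσ (t : ℝ) (ht : t ∈ I) : (t : EReal) ≤ σ := by
    rcases hI with rfl | rfl | rfl | rfl
    · exact ht.2.le
    · exact ht.2
    · exact ht.2.le
    · exact ht.2
  have hsub (t : ℝ) (ht : t ∈ I) : IooE t σ ⊆ I := by
    intro s hs
    have h1 := EReal.coe_lt_coe_iff.2 hs.1
    rcases hI with rfl | rfl | rfl | rfl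
    · exact ⟨ht.1.trans h1, hs.2⟩
    · exact ⟨ht.1.trans h1, hs.2.le⟩
    · exact ⟨ht.1.trans h1.le, hs.2⟩
    · exact ⟨ht.1.trans h1.le, hs.2.le⟩
  obtain ⟨t₀, ht₀, ht₀σ⟩ : ∃ t ∈ I, (t : EReal) < σ := by
    obtain ⟨t, h1, h2⟩ := EReal.lt_iff_exists_real_btwn.1 hτσ
    refine ⟨t, ?_, h2⟩
    rcases hI with rfl | rfl | rfl | rfl
    exacts [⟨h1, h2⟩, ⟨h1, h2.le⟩, ⟨h1.le, h2⟩, ⟨h1.le, h2.le⟩]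
  have hρ : ContinuousOn ρ I := fun t ht => (hρd t ht).continuousWithinAt
  have hp : ContinuousOn (fun t => ρ t + β t / α t) I := hρ.add (hβ.div hα hα0)
  have hf₁c := continuousOn_f₁ hI' hσ hsub hα hp hα0 hf₁int
  obtain ⟨C, hC⟩ := hf₁bdd
  obtain ⟨D, hD⟩ := hf₂bdd
  have hf₁C (t : ℝ) (ht : t ∈ I) : f₁ σ α β ρ t ≤ C := hC (mem_image_of_mem _ ht)
  have hf₂D (t : ℝ) (ht : t ∈ I) : f₂ σ ρ t ≤ D := hD (mem_image_of_mem _ ht)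
  have hf₁0 (t : ℝ) : 0 ≤ f₁ σ α β ρ t := integral_nonneg fun s => by positivity
  have hC0 : 0 ≤ C := (hf₁0 t₀).trans (hf₁C t₀ ht₀)
  have hint (t : ℝ) (ht : t ∈ I) : IntegrableOn
      (fun s => f₁ σ α β ρ s * Real.exp (-∫ μ in t..s, (ρ μ).re)) (IooE t σ) := by
    refine (hf₂int t ht).bdd_mul (c := C)
      ((hf₁c.mono (hsub t ht)).aestronglyMeasurable (measurableSet_IooE t σ)) ?_
    filter_upwards [ae_restrict_mem (measurableSet_IooE t σ)] with s hs
    rw [Real.norm_of_nonneg (hf₁0 s)]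
    exact hf₁C s (hsub t ht hs)
  set F : ℝ → ℝ := fun t => ∫ s in IooE t σ,
    f₁ σ α β ρ s * Real.exp (-∫ μ in t..s, (ρ μ).re) with hF
  have hFbdd : BddAbove (F '' I) := by
    refine ⟨C * D, ?_⟩
    rintro _ ⟨t, ht, rfl⟩
    calc F t ≤ ∫ s in IooE t σ, C * Real.exp (-∫ μ in t..s, (ρ μ).re) :=
          setIntegral_mono_on (hint t ht) ((hf₂int t ht).const_mul C)
            (measurableSet_IooE t σ) fun s hs =>
              mul_le_mul_of_nonneg_right (hf₁C s (hsub t ht hs)) (Real.exp_pos _).le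
      _ = C * f₂ σ ρ t := integral_const_mul _ _
      _ ≤ C * D := mul_le_mul_of_nonneg_left (hf₂D t ht) hC0
  have hvol (t : ℝ) (ht : (t : EReal) < σ) : 0 < volume (IooE t σ) := by
    obtain ⟨u, h1, h2⟩ := EReal.lt_iff_exists_real_btwn.1 ht
    have h1' := EReal.coe_lt_coe_iff.1 h1
    refine lt_of_lt_of_le ?_ (measure_mono (s := Ioo t u) fun s hs =>
      ⟨hs.1, (EReal.coe_lt_coe_iff.2 hs.2).trans h2⟩)
    simpa using h1'
  have hf₁pos (t : ℝ) (ht : t ∈ I) (htσ : (t : EReal) < σ) : 0 < f₁ σ α β ρ t := by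
    rw [f₁, setIntegral_pos_iff_support_of_nonneg_ae
      (Filter.Eventually.of_forall fun s => by simp only [Pi.zero_apply]; positivity)
      (hf₁int t ht)]
    refine (hvol t htσ).trans_le (measure_mono fun s hs => ⟨?_, hs⟩)
    exact div_ne_zero (Real.exp_pos _).ne' (norm_ne_zero_iff.2 (hα0 s (hsub t ht hs)))
  have hFpos : 0 < F t₀ := by
    rw [hF, setIntegral_pos_iff_support_of_nonneg_ae
      (Filter.Eventually.of_forall fun s => mul_nonneg (hf₁0 s) (Real.exp_pos _).le)
      (hint t₀ ht₀)]
    refine (hvol t₀ ht₀σ).trans_le (measure_mono fun s hs => ⟨?_, hs⟩)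
    exact (mul_pos (hf₁pos s (hsub t₀ ht₀ hs) hs.2) (Real.exp_pos _)).ne'
  suffices hmain : IsUlamConstant n I α β γ f (sSup (F '' I)) from ⟨⟨_, hmain⟩, hmain⟩
  refine ⟨hFpos.trans_le (le_csSup hFbdd (mem_image_of_mem F ht₀)), ?_⟩
  intro ε hε ξ ξd ξdd hξ hξd hξdd hle
  have hξc : ContinuousOn ξ I := fun t ht => (hξ t ht).continuousWithinAt
  have hξdc : ContinuousOn ξd I := fun t ht => (hξd t ht).continuousWithinAt
  set g : ℝ → EuclideanSpace ℂ (Fin n) := fun t =>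
    (α t)⁻¹ • (α t • ξdd t + β t • ξd t + γ t • ξ t - f t) with hg
  have hgc : ContinuousOn g I :=
    (hα.inv₀ hα0).smul ((((hα.smul hξdd).add (hβ.smul hξdc)).add (hγ.smul hξc)).sub hf)
  have hg_le (t : ℝ) (ht : t ∈ I) : ‖g t‖ ≤ ε / ‖α t‖ := by
    rw [hg, norm_smul, norm_inv, div_eq_inv_mul]
    exact mul_le_mul_of_nonneg_left (hle t ht) (by positivity)
  have hbound₁ (t : ℝ) (ht : t ∈ I) (s : ℝ) (hs : s ∈ IooE t σ) :
      ‖Complex.exp (∫ μ in t..s, (ρ μ + β μ / α μ)) • g s‖ ≤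
        ε * (Real.exp (∫ μ in t..s, (ρ μ + β μ / α μ).re) / ‖α s‖) := by
    rw [norm_smul, norm_exp_intervalIntegral hI' hp ht (hsub t ht hs)]
    calc _ ≤ Real.exp (∫ μ in t..s, (ρ μ + β μ / α μ).re) * (ε / ‖α s‖) :=
          mul_le_mul_of_nonneg_left (hg_le s (hsub t ht hs)) (Real.exp_pos _).le
      _ = _ := by ring
  have hint₁ (t : ℝ) (ht : t ∈ I) : IntegrableOn
      (fun s => Complex.exp (∫ μ in t..s, (ρ μ + β μ / α μ)) • g s) (IooE t σ) := by
    refine Integrable.mono' ((hf₁int t ht).const_mul ε)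
      ((((continuousOn_exp_intervalIntegral hI' hp ht).smul hgc).mono
        (hsub t ht)).aestronglyMeasurable (measurableSet_IooE t σ)) ?_
    filter_upwards [ae_restrict_mem (measurableSet_IooE t σ)] with s hs
    exact hbound₁ t ht s hs
  set w : ℝ → EuclideanSpace ℂ (Fin n) := fun t =>
    -∫ s in IooE t σ, Complex.exp (∫ μ in t..s, (ρ μ + β μ / α μ)) • g s with hw
  have hwd (t : ℝ) (ht : t ∈ I) :
      HasDerivWithinAt w (g t - (ρ t + β t / α t) • w t) I t :=
    hasDerivWithinAt_variation_of_constants hI' hσ hsub hp hgc hint₁ ht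
  have hwc : ContinuousOn w I := fun t ht => (hwd t ht).continuousWithinAt
  have hw_le (t : ℝ) (ht : t ∈ I) : ‖w t‖ ≤ ε * f₁ σ α β ρ t := by
    rw [hw, norm_neg, f₁, ← integral_const_mul]
    refine norm_integral_le_of_norm_le ((hf₁int t ht).const_mul ε) ?_
    filter_upwards [ae_restrict_mem (measurableSet_IooE t σ)] with s hs
    exact hbound₁ t ht s hs
  have hρn : ContinuousOn (fun t => -ρ t) I := hρ.neg
  have hbound₂ (t : ℝ) (ht : t ∈ I) (s : ℝ) (hs : s ∈ IooE t σ) :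
      ‖Complex.exp (∫ μ in t..s, -ρ μ) • w s‖ ≤
        ε * (f₁ σ α β ρ s * Real.exp (-∫ μ in t..s, (ρ μ).re)) := by
    rw [norm_smul, norm_exp_intervalIntegral hI' hρn ht (hsub t ht hs)]
    simp only [Complex.neg_re, intervalIntegral.integral_neg]
    calc _ ≤ Real.exp (-∫ μ in t..s, (ρ μ).re) * (ε * f₁ σ α β ρ s) :=
          mul_le_mul_of_nonneg_left (hw_le s (hsub t ht hs)) (Real.exp_pos _).le
      _ = _ := by ring
  have hint₂ (t : ℝ) (ht : t ∈ I) : IntegrableOn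
      (fun s => Complex.exp (∫ μ in t..s, -ρ μ) • w s) (IooE t σ) := by
    refine Integrable.mono' ((hint t ht).const_mul ε)
      ((((continuousOn_exp_intervalIntegral hI' hρn ht).smul hwc).mono
        (hsub t ht)).aestronglyMeasurable (measurableSet_IooE t σ)) ?_
    filter_upwards [ae_restrict_mem (measurableSet_IooE t σ)] with s hs
    exact hbound₂ t ht s hs
  set z : ℝ → EuclideanSpace ℂ (Fin n) := fun t =>
    -∫ s in IooE t σ, Complex.exp (∫ μ in t..s, -ρ μ) • w s with hz
  have hzd (t : ℝ) (ht : t ∈ I) : HasDerivWithinAt z (w t + ρ t • z t) I t :=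
    (hasDerivWithinAt_variation_of_constants hI' hσ hsub hρn hwc hint₂ ht).congr_deriv
      (by rw [neg_smul, sub_neg_eq_add])
  have hzc : ContinuousOn z I := fun t ht => (hzd t ht).continuousWithinAt
  have hz_le (t : ℝ) (ht : t ∈ I) : ‖z t‖ ≤ ε * F t := by
    rw [hz, norm_neg, hF, ← integral_const_mul]
    refine norm_integral_le_of_norm_le ((hint t ht).const_mul ε) ?_
    filter_upwards [ae_restrict_mem (measurableSet_IooE t σ)] with s hs
    exact hbound₂ t ht s hs
  refine ⟨fun t => ξ t - z t, fun t => ξd t - (w t + ρ t • z t),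
    fun t => ξdd t - (g t - (ρ t + β t / α t) • w t +
      (ρ t • (w t + ρ t • z t) + ρ' t • z t)),
    fun t ht => (hξ t ht).sub (hzd t ht),
    fun t ht => (hξd t ht).sub ((hwd t ht).add ((hρd t ht).smul (hzd t ht))),
    hξdd.sub ((hgc.sub (hp.smul hwc)).add
      ((hρ.smul (hwc.add (hρ.smul hzc))).add (hρc.smul hzc))), ?_, ?_⟩
  · intro t ht
    have hαt := hα0 t ht
    have hαg : α t • g t = α t • ξdd t + β t • ξd t + γ t • ξ t - f t := by
      rw [hg, smul_smul, mul_inv_cancel₀ hαt, one_smul]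
    have hβ' : α t * (β t / α t) = β t := mul_div_cancel₀ _ hαt
    have hγ' : γ t = -(α t * (ρ' t + ρ t ^ 2) + β t * ρ t) :=
      eq_neg_of_add_eq_zero_right (hRic t ht)
    have hz_eq : α t • (g t - (ρ t + β t / α t) • w t +
        (ρ t • (w t + ρ t • z t) + ρ' t • z t)) + β t • (w t + ρ t • z t) + γ t • z t =
        α t • g t := by
      rw [hγ', ← sub_eq_zero]
      have : α t • ((β t / α t) • w t) = β t • w t := by rw [smul_smul, hβ']
      rw [smul_add, smul_sub, add_smul, smul_add (α t) (ρ t • w t), this]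
      module
    calc _ = (α t • ξdd t + β t • ξd t + γ t • ξ t) -
          (α t • (g t - (ρ t + β t / α t) • w t +
            (ρ t • (w t + ρ t • z t) + ρ' t • z t)) + β t • (w t + ρ t • z t) +
              γ t • z t) := by
          simp only [smul_sub]; abel
      _ = f t := by rw [hz_eq, hαg]; abel
  · intro t ht
    rw [sub_sub_cancel, mul_comm]
    exact (hz_le t ht).trans
      (mul_le_mul_of_nonneg_left (le_csSup hFbdd (mem_image_of_mem F ht)) hε.le)
end

section
/- Given ε > 0, the function x(t) = ε(1 − t/2) is a solution of t(1−t)x''(t) + (2−t)x'(t) + x(t) = 0 on (0,1), the constant function ξ(t) ≡ ε satisfies t(1−t)ξ''(t) + (2−t)ξ'(t) + ξ(t) = ε for all t ∈ (0,1), and sup_{t∈(0,1)} |ξ(t) − x(t)| = ε/2. -/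
open Set

/-- for `x(t) = ε(1 - t/2)` and `ξ ≡ ε` on `(0,1)`:
`x` solves `t(1-t)x'' + (2-t)x' + x = 0`, `ξ` satisfies
`t(1-t)ξ'' + (2-t)ξ' + ξ = ε`, and `sup_{t∈(0,1)} |ξ(t) - x(t)| = ε/2`. -/
theorem singular_equation_sharpness (ε : ℝ) (hε : 0 < ε) :
    (∀ t ∈ Ioo (0 : ℝ) 1,
      t * (1 - t) * deriv (deriv (fun s : ℝ => ε * (1 - s / 2))) t
        + (2 - t) * deriv (fun s : ℝ => ε * (1 - s / 2)) t
        + ε * (1 - t / 2) = 0) ∧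
    (∀ t ∈ Ioo (0 : ℝ) 1,
      t * (1 - t) * deriv (deriv (fun _ : ℝ => ε)) t
        + (2 - t) * deriv (fun _ : ℝ => ε) t + ε = ε) ∧
    sSup ((fun t => |ε - ε * (1 - t / 2)|) '' Ioo (0 : ℝ) 1) = ε / 2 := by
  have hderiv : deriv (fun s : ℝ => ε * (1 - s / 2)) = fun _ => -(ε / 2) := by
    funext t
    have h : HasDerivAt (fun s : ℝ => ε * (1 - s / 2)) (ε * -(1 / 2)) t :=
      (((hasDerivAt_id' t).div_const 2).const_sub 1).const_mul ε
    rw [h.deriv]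
    ring
  have himage : (fun t => |ε - ε * (1 - t / 2)|) '' Ioo (0 : ℝ) 1 = Ioo 0 (ε / 2) := by
    have habs : ∀ t : ℝ, 0 < t → |ε - ε * (1 - t / 2)| = ε / 2 * t := fun t ht => by
      rw [show ε - ε * (1 - t / 2) = ε / 2 * t by ring, abs_of_pos (by positivity)]
    ext y
    constructor
    · rintro ⟨t, ⟨ht0, ht1⟩, rfl⟩
      simp only [habs t ht0]
      exact ⟨by positivity, by nlinarith⟩
    · rintro ⟨hy0, hy1⟩
      have ht : 0 < y / (ε / 2) := by positivity
      refine ⟨y / (ε / 2), ⟨ht, (div_lt_one (by positivity)).2 hy1⟩, ?_⟩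
      simp only [habs _ ht]
      field_simp
  refine ⟨fun t _ => ?_, fun t _ => ?_, ?_⟩
  · simp only [hderiv, deriv_const]
    ring
  · simp
  · rw [himage, csSup_Ioo (by positivity)]
end
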